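/- Let n ≥ 1, N ≥ 1 and let ℰ : (0,∞)×Sⁿ → ℒ(ℂ^N) be measurable. Define the multiplicator norm ‖ℰ‖_* := sup { ( ∫_0^∞ ‖(ℰf)_t‖₂² max(t⁻¹,1) dt )^{1/2} : f measurable with ∫_{Sⁿ} Ñ*(f)² dσ + ∫_1^∞ ‖f_t‖₂² dt ≤ 1 }, where (ℰf)(t,x) := ℰ(t,x)f(t,x). Then there exist constants C, C' < ∞, depending only on n, N, c₀, c₁, r₀, such that ess sup_{(t,x)} ‖ℰ(t,x)‖ ≤ C ‖ℰ‖_* and ‖ℰ‖_* ≤ C' ( ‖ℰ‖_C + ess sup_{(t,x)} ‖ℰ(t,x)‖ ), where the modified Carleson norm is ‖ℰ‖_C := ( sup_{Q} (1/σ(Q)) ∬_{(0,r(Q))×Q} ( ess sup_{(s,y) ∈ W(t,x)} ‖ℰ(s,y)‖ )² dt dσ(x)/t )^{1/2}, the supremum being over metric balls Q ⊂ Sⁿ of radius r(Q) < r₀ for some fixed r₀ < 1. -/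

import Mathlib

open MeasureTheory Metric
open scoped ENNReal NNReal

/-- Borel measurable structure on `ℂ^N`. -/
noncomputable instance euclideanComplexMeasurableSpace (N : ℕ) :
    MeasurableSpace (EuclideanSpace ℂ (Fin N)) := borel _

instance euclideanComplexBorelSpace (N : ℕ) :
    BorelSpace (EuclideanSpace ℂ (Fin N)) := ⟨rfl⟩

/-- The surface measure on the unit sphere `Sⁿ ⊂ ℝ^{1+n}`. -/
noncomputable def sphereMeasure (n : ℕ) :
    Measure (sphere (0 : EuclideanSpace ℝ (Fin (n + 1))) 1) :=
  (volume : Measure (EuclideanSpace ℝ (Fin (n + 1)))).toSphere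

/-- The product measure `ds dσ(y)` on `ℝ × Sⁿ`. -/
noncomputable def stripMeasure (n : ℕ) :
    Measure (ℝ × sphere (0 : EuclideanSpace ℝ (Fin (n + 1))) 1) :=
  (volume : Measure ℝ).prod (sphereMeasure n)

/-- The Whitney region `W(t,x) = {(s,y) : |y − x| < c₁ t, c₀⁻¹ < s/t < c₀}`. -/
def whitneyRegion (n : ℕ) (c₀ c₁ : ℝ)
    (t : ℝ) (x : sphere (0 : EuclideanSpace ℝ (Fin (n + 1))) 1) :
    Set (ℝ × sphere (0 : EuclideanSpace ℝ (Fin (n + 1))) 1) :=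
  {z | dist (z.2 : EuclideanSpace ℝ (Fin (n + 1))) (x : EuclideanSpace ℝ (Fin (n + 1)))
        < c₁ * t ∧ c₀⁻¹ < z.1 / t ∧ z.1 / t < c₀}

/-- `‖f_s‖₂²`, the squared `L²(Sⁿ)` norm of the slice `f_s = f(s, ·)`. -/
noncomputable def sliceNormSq (n N : ℕ)
    (f : ℝ × sphere (0 : EuclideanSpace ℝ (Fin (n + 1))) 1 → EuclideanSpace ℂ (Fin N))
    (s : ℝ) : ℝ≥0∞ :=
  ∫⁻ x, ((‖f (s, x)‖₊ : ℝ≥0∞) ^ 2) ∂(sphereMeasure n)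

/-- The modified non-tangential maximal function
`Ñ*(f)(x) = sup_{0<t<c₀} t^{−(1+n)/2} (∬_{W(t,x)} |f(s,y)|² χ_{s<1} ds dσ(y))^{1/2}`. -/
noncomputable def ntMaximal (n N : ℕ) (c₀ c₁ : ℝ)
    (f : ℝ × sphere (0 : EuclideanSpace ℝ (Fin (n + 1))) 1 → EuclideanSpace ℂ (Fin N))
    (x : sphere (0 : EuclideanSpace ℝ (Fin (n + 1))) 1) : ℝ≥0∞ :=
  ⨆ t ∈ Set.Ioo (0 : ℝ) c₀,
    ENNReal.ofReal t ^ (-(1 + (n : ℝ)) / 2) *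
      (∫⁻ z in whitneyRegion n c₀ c₁ t x ∩ {z | z.1 < 1},
        ((‖f z‖₊ : ℝ≥0∞) ^ 2) ∂(stripMeasure n)) ^ ((1 : ℝ) / 2)

/-- The squared `𝒳`-norm `‖Ñ*(f)‖₂² + ∫_1^∞ ‖f_t‖₂² dt`. -/
noncomputable def XnormSq (n N : ℕ) (c₀ c₁ : ℝ)
    (f : ℝ × sphere (0 : EuclideanSpace ℝ (Fin (n + 1))) 1 → EuclideanSpace ℂ (Fin N)) :
    ℝ≥0∞ :=
  (∫⁻ x, (ntMaximal n N c₀ c₁ f x) ^ 2 ∂(sphereMeasure n)) +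
    ∫⁻ s in Set.Ioi (1 : ℝ), sliceNormSq n N f s

/-- The squared `𝒴*`-norm `∫_0^∞ ‖f_t‖₂² max(t⁻¹,1) dt`. -/
noncomputable def YstarNormSq (n N : ℕ)
    (f : ℝ × sphere (0 : EuclideanSpace ℝ (Fin (n + 1))) 1 → EuclideanSpace ℂ (Fin N)) :
    ℝ≥0∞ :=
  ∫⁻ s in Set.Ioi (0 : ℝ),
    sliceNormSq n N f s * max (ENNReal.ofReal s)⁻¹ 1

/-- The multiplicator norm `‖ℰ‖_* = sup {‖ℰf‖_{𝒴*} : f measurable, ‖f‖_𝒳 ≤ 1}`. -/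
noncomputable def multiplicatorNorm (n N : ℕ) (c₀ c₁ : ℝ)
    (ℰ : ℝ × sphere (0 : EuclideanSpace ℝ (Fin (n + 1))) 1 →
      (EuclideanSpace ℂ (Fin N) →L[ℂ] EuclideanSpace ℂ (Fin N))) : ℝ≥0∞ :=
  ⨆ (f : ℝ × sphere (0 : EuclideanSpace ℝ (Fin (n + 1))) 1 → EuclideanSpace ℂ (Fin N))
    (_ : Measurable f ∧ XnormSq n N c₀ c₁ f ≤ 1),
      (YstarNormSq n N (fun z => ℰ z (f z))) ^ ((1 : ℝ) / 2)

/-- The modified Carleson norm `‖ℰ‖_C`. -/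
noncomputable def carlesonNorm (n N : ℕ) (c₀ c₁ r₀ : ℝ)
    (ℰ : ℝ × sphere (0 : EuclideanSpace ℝ (Fin (n + 1))) 1 →
      (EuclideanSpace ℂ (Fin N) →L[ℂ] EuclideanSpace ℂ (Fin N))) : ℝ≥0∞ :=
  (⨆ (x₀ : sphere (0 : EuclideanSpace ℝ (Fin (n + 1))) 1) (r : ℝ)
      (_ : 0 < r ∧ r < r₀),
    (sphereMeasure n (Metric.ball x₀ r))⁻¹ *
      ∫⁻ z in (Set.Ioo (0 : ℝ) r) ×ˢ (Metric.ball x₀ r),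
        (essSup (fun w => (‖ℰ w‖₊ : ℝ≥0∞))
            ((stripMeasure n).restrict (whitneyRegion n c₀ c₁ z.1 z.2))) ^ 2 *
          (ENNReal.ofReal z.1)⁻¹ ∂(stripMeasure n)) ^ ((1 : ℝ) / 2)

/-- Layer cake formula for `ℝ≥0∞`-valued functions. -/
theorem lintegral_eq_lintegral_measure_ofReal_lt {α : Type*} [MeasurableSpace α]
    (μ : Measure α) [SFinite μ] {g : α → ℝ≥0∞} (hg : Measurable g) :
    ∫⁻ x, g x ∂μ = ∫⁻ l in Set.Ioi (0 : ℝ), μ {x | ENNReal.ofReal l < g x} := by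
  have hset : MeasurableSet {p : α × ℝ | ENNReal.ofReal p.2 < g p.1} :=
    measurableSet_lt (by fun_prop) (by fun_prop)
  have hvol (y : ℝ≥0∞) : volume.restrict (Set.Ioi (0 : ℝ)) {l | ENNReal.ofReal l < y} = y := by
    rw [Measure.restrict_apply (measurableSet_lt (by fun_prop) measurable_const)]
    induction y with
    | top => simp
    | coe y =>
      have : {l : ℝ | ENNReal.ofReal l < y} ∩ Set.Ioi 0 = Set.Ioo 0 (y : ℝ) := by
        ext l
        simp only [Set.mem_inter_iff, Set.mem_ofPred_eq, Set.mem_Ioi, Set.mem_Ioo]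
        refine ⟨fun h => ⟨h.2, ?_⟩, fun h => ⟨?_, h.1⟩⟩
        · simpa using (ENNReal.ofReal_lt_iff_lt_toReal h.2.le ENNReal.coe_ne_top).1 h.1
        · exact (ENNReal.ofReal_lt_iff_lt_toReal h.1.le ENNReal.coe_ne_top).2 (by simpa using h.2)
      rw [this]
      simp
  calc ∫⁻ x, g x ∂μ
      = ∫⁻ x, volume.restrict (Set.Ioi (0 : ℝ)) (Prod.mk x ⁻¹' {p | ENNReal.ofReal p.2 < g p.1})
          ∂μ := lintegral_congr fun x => (hvol (g x)).symm
    _ = (μ.prod (volume.restrict (Set.Ioi (0 : ℝ)))) {p | ENNReal.ofReal p.2 < g p.1} :=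
        (Measure.prod_apply hset).symm
    _ = _ := Measure.prod_apply_symm hset

/-- **Carleson embedding**: if `μ` is a Carleson measure with respect to `σ` and `G` is
non-tangentially dominated by `g`, then `∫ G dμ` over the strip `0 < t < δ` is controlled by
`∫ g dσ`. -/
theorem carleson_embedding {X : Type*} [PseudoMetricSpace X] [MeasurableSpace X] [BorelSpace X]
    [SecondCountableTopology X] (σ : Measure X) [SFinite σ] (μ : Measure (ℝ × X)) [SFinite μ]
    {a δ : ℝ} (ha : 0 < a) {κ : ℝ≥0∞}
    (hμ : ∀ x t, 0 < t → t < δ →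
      μ (Set.Ioo 0 ((3 * a + 3) * t) ×ˢ ball x ((3 * a + 3) * t)) ≤ κ * σ (closedBall x (a * t)))
    {G : ℝ × X → ℝ≥0∞} (hG : Measurable G) {g : X → ℝ≥0∞}
    (hGg : ∀ t x y, 0 < t → t < δ → dist y x < 2 * a * t → G (t, x) ≤ g y) :
    ∫⁻ z in Set.Ioo 0 δ ×ˢ Set.univ, G z ∂μ ≤ κ * ∫⁻ x, g x ∂σ := by
  classical
  set g' : X → ℝ≥0∞ := fun y => ⨆ z ∈ Set.Ioo 0 δ ×ˢ (Set.univ : Set X),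
    (ball z.2 (2 * a * z.1)).indicator (fun _ => G z) y with hg'
  have hg'meas : Measurable g' :=
    (lowerSemicontinuous_biSup fun z _ =>
      isOpen_ball.lowerSemicontinuous_indicator (zero_le)).measurable
  have hg'le : ∀ y, g' y ≤ g y := by
    intro y
    refine iSup₂_le fun z hz => ?_
    exact Set.indicator_le' (fun y h => hGg z.1 z.2 y hz.1.1 hz.1.2 h) (fun _ _ => zero_le) y
  have hlevel : ∀ l : ℝ≥0∞, (μ.restrict (Set.Ioo 0 δ ×ˢ Set.univ)) {z | l < G z}
      ≤ κ * σ {y | l < g' y} := by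
    intro l
    rw [Measure.restrict_apply (measurableSet_lt measurable_const hG)]
    set S : Set (ℝ × X) := {z | l < G z} ∩ Set.Ioo 0 δ ×ˢ Set.univ
    obtain ⟨u, huS, hdisj, hcov⟩ := Vitali.exists_disjoint_subfamily_covering_enlargement
      (fun z : ℝ × X => closedBall z.2 (a * z.1)) S (fun z => z.1) 2 one_lt_two
      (fun z hz => hz.2.1.1.le) δ (fun z hz => hz.2.1.2.le)
      (fun z hz => nonempty_closedBall.2 (mul_nonneg ha.le hz.2.1.1.le))
    have hucount : u.Countable := hdisj.countable_of_nonempty_interior fun z hz => by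
      have hz' := (huS hz).2.1.1
      exact (nonempty_ball.2 (mul_pos ha hz')).mono ball_subset_interior_closedBall
    have hSsub : S ⊆ ⋃ z ∈ u, Set.Ioo 0 ((3 * a + 3) * z.1) ×ˢ ball z.2 ((3 * a + 3) * z.1) := by
      rintro ⟨t, x⟩ hz
      obtain ⟨⟨s, y⟩, hbu, ⟨w, hw1, hw2⟩, hle⟩ := hcov _ hz
      have hs : 0 < s := (huS hbu).2.1.1
      have ht : 0 < t := hz.2.1.1
      simp only [mem_closedBall] at hw1 hw2 hle
      refine Set.mem_biUnion hbu ⟨⟨ht, ?_⟩, ?_⟩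
      · simp only
        nlinarith [mul_pos ha hs]
      · have := dist_triangle_left x y w
        have h2 : a * t ≤ a * (2 * s) := by gcongr
        simp only [mem_ball]
        linarith
    calc μ S ≤ ∑' z : u, μ (Set.Ioo 0 ((3 * a + 3) * z.1.1) ×ˢ ball z.1.2 ((3 * a + 3) * z.1.1)) :=
          (measure_mono hSsub).trans (measure_biUnion_le _ hucount _)
      _ ≤ ∑' z : u, κ * σ (closedBall z.1.2 (a * z.1.1)) :=
          ENNReal.tsum_le_tsum fun z => hμ _ _ (huS z.2).2.1.1 (huS z.2).2.1.2
      _ = κ * σ (⋃ z ∈ u, closedBall z.2 (a * z.1)) := by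
          rw [ENNReal.tsum_mul_left, measure_biUnion hucount hdisj
            fun _ _ => isClosed_closedBall.measurableSet]
      _ ≤ κ * σ {y | l < g' y} := by
          gcongr
          refine Set.iUnion₂_subset fun z hz y hy => ?_
          have hzS := huS hz
          have hyb : y ∈ ball z.2 (2 * a * z.1) := by
            have := mul_pos ha hzS.2.1.1
            rw [mem_closedBall] at hy
            rw [mem_ball]
            linarith
          have hlt : l < G z := hzS.1
          refine hlt.trans_le (le_iSup₂_of_le z hzS.2 ?_)
          rw [Set.indicator_of_mem hyb]
  calc ∫⁻ z in Set.Ioo 0 δ ×ˢ Set.univ, G z ∂μ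
      ≤ ∫⁻ l in Set.Ioi (0 : ℝ), κ * σ {y | ENNReal.ofReal l < g' y} := by
        rw [lintegral_eq_lintegral_measure_ofReal_lt _ hG]
        exact lintegral_mono fun l => hlevel _
    _ = κ * ∫⁻ x, g' x ∂σ := by
        rw [lintegral_const_mul, lintegral_eq_lintegral_measure_ofReal_lt _ hg'meas]
        have : Antitone fun l : ℝ => σ {y | ENNReal.ofReal l < g' y} := fun l m hlm =>
          measure_mono fun y hy => (ENNReal.ofReal_le_ofReal hlm).trans_lt hy
        exact this.measurable
    _ ≤ κ * ∫⁻ x, g x ∂σ := by gcongr; exact hg'le _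

theorem volumeIoiPow_preimage_Ioo (n : ℕ) (a b : ℝ) (ha : 0 ≤ a) :
    Measure.volumeIoiPow n (Subtype.val ⁻¹' Set.Ioo a b) =
      ∫⁻ r in Set.Ioo a b, ENNReal.ofReal (r ^ n) := by
  rw [Measure.volumeIoiPow, withDensity_apply _ (measurable_subtype_coe measurableSet_Ioo),
    setLIntegral_subtype measurableSet_Ioi _ fun a : ℝ ↦ .ofReal (a ^ n)]
  congr 2
  rw [Subtype.image_preimage_coe, Set.inter_eq_right]
  exact fun r hr => ha.trans_lt hr.1

section PolarCoordinates

variable {E : Type*} [NormedAddCommGroup E] [NormedSpace ℝ E] [FiniteDimensional ℝ E]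
  [MeasurableSpace E] [BorelSpace E] (μ : Measure E) [μ.IsAddHaarMeasure]

/-- The measure of a truncated cone in polar coordinates. -/
theorem toSphere_mul_lintegral_eq_measure_cone {n : ℕ} (hE : Module.finrank ℝ E = n + 1)
    {s : Set (sphere (0 : E) 1)} (hs : MeasurableSet s) {a b : ℝ} (ha : 0 ≤ a) :
    μ.toSphere s * ∫⁻ r in Set.Ioo a b, ENNReal.ofReal (r ^ n) =
      μ (Subtype.val '' (homeomorphUnitSphereProd E ⁻¹' (s ×ˢ (Subtype.val ⁻¹' Set.Ioo a b)))) := by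
  have hS : MeasurableSet (s ×ˢ (Subtype.val ⁻¹' Set.Ioo a b : Set (Set.Ioi (0 : ℝ)))) :=
    hs.prod (measurable_subtype_coe measurableSet_Ioo)
  have h := (μ.measurePreserving_homeomorphUnitSphereProd).measure_preimage hS.nullMeasurableSet
  rw [Measure.prod_prod, hE, Nat.add_sub_cancel, volumeIoiPow_preimage_Ioo n a b ha] at h
  rw [← h, (MeasurableEmbedding.subtype_coe (measurableSet_singleton _).compl).comap_apply]

theorem toSphere_ball_le {n : ℕ} (hE : Module.finrank ℝ E = n + 1) (x : sphere (0 : E) 1)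
    {ρ : ℝ} (hρ : 0 < ρ) :
    μ.toSphere (ball x ρ) ≤ ENNReal.ofReal (2 ^ (n + 1) * ρ ^ n) * μ (ball 0 1) := by
  have hcone := toSphere_mul_lintegral_eq_measure_cone μ hE (s := ball x ρ) measurableSet_ball
    (a := 1) (b := 1 + ρ) zero_le_one
  have hbound : ENNReal.ofReal ρ ≤ ∫⁻ r in Set.Ioo 1 (1 + ρ), ENNReal.ofReal (r ^ n) := by
    calc ENNReal.ofReal ρ = ∫⁻ r in Set.Ioo 1 (1 + ρ), (1 : ℝ≥0∞) := by simp
      _ ≤ _ := setLIntegral_mono' measurableSet_Ioo fun r hr => by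
        rw [← ENNReal.ofReal_one]
        exact ENNReal.ofReal_le_ofReal (one_le_pow₀ hr.1.le)
  have hsub : Subtype.val '' (homeomorphUnitSphereProd E ⁻¹'
      (ball x ρ ×ˢ (Subtype.val ⁻¹' Set.Ioo 1 (1 + ρ)))) ⊆ ball (x : E) (2 * ρ) := by
    rintro _ ⟨z, ⟨hz1, hz2⟩, rfl⟩
    simp only [mem_ball, Subtype.dist_eq, homeomorphUnitSphereProd_apply_fst_coe, dist_eq_norm,
      Set.mem_preimage, homeomorphUnitSphereProd_apply_snd_coe, Set.mem_Ioo] at hz1 hz2 ⊢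
    have hz : ‖(z : E)‖ ≠ 0 := by linarith [hz2.1]
    have h1 : (z : E) - ‖(z : E)‖⁻¹ • (z : E) = (1 - ‖(z : E)‖⁻¹) • (z : E) := by
      rw [sub_smul, one_smul]
    have h2 : ‖(z : E) - ‖(z : E)‖⁻¹ • (z : E)‖ = ‖(z : E)‖ - 1 := by
      rw [h1, norm_smul, Real.norm_of_nonneg (sub_nonneg.2 (inv_le_one_of_one_le₀ hz2.1.le))]
      field_simp
    have := norm_sub_le_norm_sub_add_norm_sub (z : E) (‖(z : E)‖⁻¹ • (z : E)) (x : E)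
    linarith
  have hle : μ.toSphere (ball x ρ) * ENNReal.ofReal ρ ≤
      ENNReal.ofReal ((2 * ρ) ^ (n + 1)) * μ (ball 0 1) := by
    rw [← hE, ← Measure.addHaar_ball_of_pos μ (x : E) (by positivity)]
    exact (mul_le_mul_right hbound _).trans (hcone.le.trans (measure_mono hsub))
  have hρ0 : ENNReal.ofReal ρ ≠ 0 := by simpa using hρ
  refine (ENNReal.mul_le_mul_iff_left hρ0 ENNReal.ofReal_ne_top).1 (hle.trans_eq ?_)
  rw [mul_right_comm, ← ENNReal.ofReal_mul (by positivity)]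
  congr 2
  ring

theorem le_toSphere_ball {n : ℕ} (hE : Module.finrank ℝ E = n + 1) (x : sphere (0 : E) 1)
    {ρ : ℝ} (hρ : 0 < ρ) (hρ1 : ρ ≤ 1) :
    ENNReal.ofReal (((2 : ℝ) ^ (n + 1))⁻¹ * (2 ^ n)⁻¹ * ρ ^ n) * μ (ball 0 1)
      ≤ μ.toSphere (ball x ρ) := by
  have hcone := toSphere_mul_lintegral_eq_measure_cone μ hE (s := ball x ρ) measurableSet_ball
    (a := 1 - ρ / 2) (b := 1 + ρ / 2) (by linarith)
  have hbound : ∫⁻ r in Set.Ioo (1 - ρ / 2) (1 + ρ / 2), ENNReal.ofReal (r ^ n) ≤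
      ENNReal.ofReal (2 ^ n * ρ) := by
    calc _ ≤ ∫⁻ r in Set.Ioo (1 - ρ / 2) (1 + ρ / 2), ENNReal.ofReal (2 ^ n) :=
        setLIntegral_mono' measurableSet_Ioo fun r hr => by
          refine ENNReal.ofReal_le_ofReal ?_
          have h0 : 0 ≤ r := by linarith [hr.1]
          have h2 : r ≤ 2 := by linarith [hr.2]
          gcongr
      _ = _ := by
        rw [setLIntegral_const, Real.volume_Ioo, ENNReal.ofReal_mul (by positivity)]
        congr 2
        ring
  have hsub : ball (x : E) (ρ / 2) ⊆ Subtype.val '' (homeomorphUnitSphereProd E ⁻¹'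
      (ball x ρ ×ˢ (Subtype.val ⁻¹' Set.Ioo (1 - ρ / 2) (1 + ρ / 2)))) := by
    intro z hz
    have hx : ‖(x : E)‖ = 1 := by simp
    rw [mem_ball, dist_eq_norm] at hz
    have habs := (abs_norm_sub_norm_le z (x : E)).trans_lt hz
    rw [hx, abs_lt] at habs
    have hzpos : 0 < ‖z‖ := by linarith [habs.1]
    refine ⟨⟨z, by simpa using hzpos⟩, ⟨?_, ?_⟩, rfl⟩
    · simp only [mem_ball, Subtype.dist_eq, homeomorphUnitSphereProd_apply_fst_coe, dist_eq_norm]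
      have h1 : ‖z‖⁻¹ • z - z = (‖z‖⁻¹ * (1 - ‖z‖)) • z := by
        rw [mul_sub, inv_mul_cancel₀ hzpos.ne', sub_smul, mul_one, one_smul]
      have h2 : ‖‖z‖⁻¹ • z - z‖ < ρ / 2 := by
        rw [h1, norm_smul, norm_mul, norm_inv, norm_norm, mul_right_comm,
          inv_mul_cancel₀ hzpos.ne', one_mul, Real.norm_eq_abs, abs_lt]
        constructor <;> linarith [habs.1, habs.2]
      have := norm_sub_le_norm_sub_add_norm_sub (‖z‖⁻¹ • z) z (x : E)
      linarith
    · simp only [Set.mem_preimage, homeomorphUnitSphereProd_apply_snd_coe, Set.mem_Ioo]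
      constructor <;> linarith [habs.1, habs.2]
  have hle : ENNReal.ofReal ((ρ / 2) ^ (n + 1)) * μ (ball 0 1) ≤
      μ.toSphere (ball x ρ) * ENNReal.ofReal (2 ^ n * ρ) := by
    rw [← hE, ← Measure.addHaar_ball_of_pos μ (x : E) (by positivity)]
    exact (measure_mono hsub).trans (hcone.ge.trans (mul_le_mul_right hbound _))
  have hρ0 : ENNReal.ofReal (2 ^ n * ρ) ≠ 0 := by
    simp only [ne_eq, ENNReal.ofReal_eq_zero, not_le]
    positivity
  refine (ENNReal.mul_le_mul_iff_left hρ0 ENNReal.ofReal_ne_top).1 (le_of_eq_of_le ?_ hle)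
  rw [mul_right_comm, ← ENNReal.ofReal_mul (by positivity)]
  congr 2
  rw [div_pow]
  field_simp
  ring

end PolarCoordinates

instance (n : ℕ) : IsFiniteMeasure (sphereMeasure n) := by
  unfold sphereMeasure
  infer_instance

instance (n : ℕ) : SFinite (stripMeasure n) := by
  unfold stripMeasure
  infer_instance

/-- The surface measure on `Sⁿ` is Ahlfors regular of dimension `n`. -/
theorem sphereMeasure_ahlforsRegular (n : ℕ) (R : ℝ) :
    ∃ a b : ℝ, 0 < a ∧ 0 < b ∧
      ∀ (x : sphere (0 : EuclideanSpace ℝ (Fin (n + 1))) 1) (ρ : ℝ), 0 < ρ →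
        (ρ ≤ R → ENNReal.ofReal (a * ρ ^ n) ≤ sphereMeasure n (ball x ρ)) ∧
        sphereMeasure n (ball x ρ) ≤ ENNReal.ofReal (b * ρ ^ n) := by
  have hE : Module.finrank ℝ (EuclideanSpace ℝ (Fin (n + 1))) = n + 1 := by simp
  set m := (volume : Measure (EuclideanSpace ℝ (Fin (n + 1)))).real (ball 0 1) with hm
  have hmv : volume (ball (0 : EuclideanSpace ℝ (Fin (n + 1))) 1) = ENNReal.ofReal m :=
    (ofReal_measureReal measure_ball_lt_top.ne).symm
  have hmpos : 0 < m := ENNReal.toReal_pos (measure_ball_pos _ _ one_pos).ne'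
    measure_ball_lt_top.ne
  set K := max R 1 with hK
  have hK1 : 1 ≤ K := le_max_right _ _
  have hK0 : 0 < K := one_pos.trans_le hK1
  refine ⟨((2 : ℝ) ^ (n + 1))⁻¹ * (2 ^ n)⁻¹ * m / K ^ n, 2 ^ (n + 1) * m, by positivity,
    by positivity, fun x ρ hρ => ⟨fun hρR => ?_, ?_⟩⟩
  · have h := le_toSphere_ball volume hE x (ρ := ρ / K) (by positivity)
      ((div_le_one hK0).2 (hρR.trans (le_max_left _ _)))
    rw [hmv, ← ENNReal.ofReal_mul (by positivity)] at h
    refine le_trans (le_of_eq ?_) (h.trans (measure_mono (ball_subset_ball ?_)))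
    · congr 1
      rw [div_pow]
      ring
    · exact div_le_self hρ.le hK1
  · have h := toSphere_ball_le volume hE x hρ
    rw [hmv, ← ENNReal.ofReal_mul (by positivity)] at h
    refine h.trans (le_of_eq ?_)
    congr 1
    ring

section Measurability

variable {α β : Type*} [MeasurableSpace α] [MeasurableSpace β] (ν : Measure β) [SFinite ν]

theorem measurable_essSup_restrict_section {T : Set (α × β)} (hT : MeasurableSet T)
    {e : β → ℝ≥0∞} (he : Measurable e) :
    Measurable fun a => essSup e (ν.restrict (Prod.mk a ⁻¹' T)) := by
  refine measurable_of_Ioi fun l => ?_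
  have hl : MeasurableSet {b | l < e b} := measurableSet_lt measurable_const he
  have hset : (fun a => essSup e (ν.restrict (Prod.mk a ⁻¹' T))) ⁻¹' Set.Ioi l =
      {a | 0 < ν (Prod.mk a ⁻¹' (T ∩ Prod.snd ⁻¹' {b | l < e b}))} := by
    ext a
    rw [Set.mem_preimage, Set.mem_Ioi, Set.mem_ofPred_eq, ← not_iff_not, not_lt, not_lt,
      nonpos_iff_eq_zero]
    have hae : (∀ᵐ b ∂ν.restrict (Prod.mk a ⁻¹' T), e b ≤ l) ↔
        ν (Prod.mk a ⁻¹' (T ∩ Prod.snd ⁻¹' {b | l < e b})) = 0 := by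
      rw [ae_iff]
      simp only [not_le]
      rw [Measure.restrict_apply hl, Set.inter_comm]
      rfl
    rw [← hae]
    exact ⟨fun h => (ENNReal.ae_le_essSup e).mono fun b hb => hb.trans h,
      fun h => essSup_le_of_ae_le l h⟩
  rw [hset]
  exact measurableSet_lt measurable_const
    (measurable_measure_prodMk_left (hT.inter (measurable_snd hl)))

theorem measurable_setLIntegral_section {T : Set (α × β)} (hT : MeasurableSet T)
    {F : β → ℝ≥0∞} (hF : Measurable F) :
    Measurable fun a => ∫⁻ b in Prod.mk a ⁻¹' T, F b ∂ν := by
  have h (a : α) : ∫⁻ b in Prod.mk a ⁻¹' T, F b ∂ν =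
      ∫⁻ b, T.indicator (fun p : α × β => F p.2) (a, b) ∂ν := by
    rw [← lintegral_indicator (measurable_prodMk_left hT)]
    rfl
  simp_rw [h]
  exact ((hF.comp measurable_snd).indicator hT).lintegral_prod_right'

end Measurability

/-- The unit sphere in `ℝ^{1+n}`. -/
abbrev UnitSphere (n : ℕ) : Type := sphere (0 : EuclideanSpace ℝ (Fin (n + 1))) 1

theorem measurable_enorm_of_forall_apply {Ω : Type*} [MeasurableSpace Ω] {N : ℕ}
    {T : Ω → EuclideanSpace ℂ (Fin N) →L[ℂ] EuclideanSpace ℂ (Fin N)}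
    (hT : ∀ v, Measurable fun z => T z v) : Measurable fun z => (‖T z‖₊ : ℝ≥0∞) := by
  let b := EuclideanSpace.basisFun (Fin N) ℂ
  let Φ : (Fin N → EuclideanSpace ℂ (Fin N)) →
      EuclideanSpace ℂ (Fin N) →L[ℂ] EuclideanSpace ℂ (Fin N) :=
    fun w => ∑ i, ContinuousLinearMap.smulRightL ℂ _ _ (innerSL ℂ (b i)) (w i)
  have hΦ : Continuous Φ := by fun_prop
  have hTΦ (z : Ω) : T z = Φ fun i => T z (b i) := by
    ext1 v
    conv_lhs => rw [← b.sum_repr' v]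
    simp [Φ]
  have hnorm : (fun z => (‖T z‖₊ : ℝ≥0∞)) = fun z => (‖Φ fun i => T z (b i)‖₊ : ℝ≥0∞) :=
    funext fun z => by rw [← hTΦ z]
  rw [hnorm]
  exact (hΦ.nnnorm.measurable.comp (measurable_pi_lambda _ fun i => hT _)).coe_nnreal_ennreal

theorem measurableSet_whitneyRegion (n : ℕ) (c₀ c₁ : ℝ) :
    MeasurableSet {p : (ℝ × UnitSphere n) × (ℝ × UnitSphere n) |
      p.2 ∈ whitneyRegion n c₀ c₁ p.1.1 p.1.2} := by
  have h1 : MeasurableSet {p : (ℝ × UnitSphere n) × (ℝ × UnitSphere n) |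
      dist (p.2.2 : EuclideanSpace ℝ (Fin (n + 1))) p.1.2 < c₁ * p.1.1} :=
    measurableSet_lt (by fun_prop) (by fun_prop)
  have h2 : MeasurableSet {p : (ℝ × UnitSphere n) × (ℝ × UnitSphere n) |
      c₀⁻¹ < p.2.1 / p.1.1} := measurableSet_lt (by fun_prop) (by fun_prop)
  have h3 : MeasurableSet {p : (ℝ × UnitSphere n) × (ℝ × UnitSphere n) |
      p.2.1 / p.1.1 < c₀} := measurableSet_lt (by fun_prop) (by fun_prop)
  exact h1.inter (h2.inter h3)

theorem measurableSet_whitneyRegion_lt_one (n : ℕ) (c₀ c₁ : ℝ) :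
    MeasurableSet {p : (ℝ × UnitSphere n) × (ℝ × UnitSphere n) |
      p.2 ∈ whitneyRegion n c₀ c₁ p.1.1 p.1.2 ∩ {z | z.1 < 1}} :=
  (measurableSet_whitneyRegion n c₀ c₁).inter (measurableSet_lt (by fun_prop) (by fun_prop))

theorem setLIntegral_stripMeasure (n : ℕ) (I : Set ℝ) {φ : ℝ × UnitSphere n → ℝ≥0∞}
    (hφ : Measurable φ) :
    ∫⁻ z in I ×ˢ Set.univ, φ z ∂stripMeasure n =
      ∫⁻ s in I, ∫⁻ x, φ (s, x) ∂sphereMeasure n := by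
  rw [stripMeasure, ← Measure.prod_restrict, Measure.restrict_univ,
    lintegral_prod _ hφ.aemeasurable]

theorem whitneyTerm_sq (n : ℕ) (t : ℝ) (J : ℝ≥0∞) :
    (ENNReal.ofReal t ^ (-(1 + (n : ℝ)) / 2) * J ^ ((1 : ℝ) / 2)) ^ 2 =
      (ENNReal.ofReal t ^ (n + 1))⁻¹ * J := by
  rw [mul_pow, ← ENNReal.rpow_natCast, ← ENNReal.rpow_natCast, ← ENNReal.rpow_mul,
    ← ENNReal.rpow_mul, ← ENNReal.rpow_natCast, ← ENNReal.rpow_neg]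
  congr 1
  · congr 1
    push_cast
    ring
  · norm_num

theorem le_ntMaximal_sq (n N : ℕ) (c₀ c₁ : ℝ) (f : ℝ × UnitSphere n → EuclideanSpace ℂ (Fin N))
    (x : UnitSphere n) {t : ℝ} (ht : t ∈ Set.Ioo 0 c₀) :
    (ENNReal.ofReal t ^ (n + 1))⁻¹ *
        ∫⁻ z in whitneyRegion n c₀ c₁ t x ∩ {z | z.1 < 1}, (‖f z‖₊ : ℝ≥0∞) ^ 2 ∂stripMeasure n ≤
      ntMaximal n N c₀ c₁ f x ^ 2 := by
  rw [← whitneyTerm_sq n]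
  gcongr
  exact le_iSup₂_of_le t ht le_rfl

theorem ntMaximal_sq_le (n N : ℕ) (c₀ c₁ : ℝ) (f : ℝ × UnitSphere n → EuclideanSpace ℂ (Fin N))
    (x : UnitSphere n) {B : ℝ≥0∞} (h : ∀ t ∈ Set.Ioo 0 c₀, (ENNReal.ofReal t ^ (n + 1))⁻¹ *
      ∫⁻ z in whitneyRegion n c₀ c₁ t x ∩ {z | z.1 < 1}, (‖f z‖₊ : ℝ≥0∞) ^ 2 ∂stripMeasure n ≤ B) :
    ntMaximal n N c₀ c₁ f x ^ 2 ≤ B := by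
  have hle : ntMaximal n N c₀ c₁ f x ≤ B ^ ((2 : ℝ)⁻¹) := by
    refine iSup₂_le fun t ht => ?_
    rw [ENNReal.le_rpow_inv_iff two_pos, ENNReal.rpow_two, whitneyTerm_sq n]
    exact h t ht
  rwa [ENNReal.le_rpow_inv_iff two_pos, ENNReal.rpow_two] at hle

/-- Averaging over Whitney regions reproduces the weight `s⁻¹`. -/
theorem exists_whitney_averaging (n : ℕ) (c₀ c : ℝ) (hc₀ : 1 < c₀) (hc : 0 < c) :
    ∃ K : ℝ≥0∞, K < ⊤ ∧ ∀ H : ℝ × UnitSphere n → ℝ≥0∞, Measurable H →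
      ∫⁻ z in Set.Ioo 0 1 ×ˢ Set.univ, H z * (ENNReal.ofReal z.1)⁻¹ ∂stripMeasure n ≤
        K * ∫⁻ p in Set.Ioo 0 c₀ ×ˢ Set.univ, (ENNReal.ofReal p.1 ^ (n + 2))⁻¹ *
          ∫⁻ z in whitneyRegion n c₀ c p.1 p.2 ∩ {z | z.1 < 1}, H z ∂stripMeasure n
            ∂stripMeasure n := by
  obtain ⟨a, b, ha, -, hab⟩ := sphereMeasure_ahlforsRegular n c
  have hc₀' : 0 < c₀ := one_pos.trans hc₀
  set k : ℝ := (1 - c₀⁻¹) * a * (c / c₀) ^ n with hk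
  have hk0 : 0 < k := by
    have : 0 < 1 - c₀⁻¹ := sub_pos.2 (inv_lt_one_of_one_lt₀ hc₀)
    positivity
  set T := {p : (ℝ × UnitSphere n) × (ℝ × UnitSphere n) |
      p.2 ∈ whitneyRegion n c₀ c p.1.1 p.1.2 ∩ {z | z.1 < 1}} with hT
  have hTm : MeasurableSet T := measurableSet_whitneyRegion_lt_one n c₀ c
  set D : ℝ × UnitSphere n → ℝ≥0∞ := fun p => (ENNReal.ofReal p.1 ^ (n + 2))⁻¹ with hD
  have hDm : Measurable D := by fun_prop
  have hpoint : ∀ z ∈ Set.Ioo (0 : ℝ) 1 ×ˢ (Set.univ : Set (UnitSphere n)),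
      (ENNReal.ofReal z.1)⁻¹ ≤ ENNReal.ofReal k⁻¹ *
        ∫⁻ p in Set.Ioo 0 c₀ ×ˢ Set.univ, T.indicator (fun q => D q.1) (p, z)
          ∂stripMeasure n := by
    rintro ⟨s, y⟩ ⟨⟨hs0, hs1⟩, -⟩
    simp only at hs0 hs1
    have hbox : MeasurableSet (Set.Ioo (s / c₀) s ×ˢ ball y (c * s / c₀)) :=
      measurableSet_Ioo.prod measurableSet_ball
    have hlow : ENNReal.ofReal (k * s⁻¹) ≤ ∫⁻ p in Set.Ioo 0 c₀ ×ˢ Set.univ,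
        T.indicator (fun q => D q.1) (p, (s, y)) ∂stripMeasure n := by
      calc ENNReal.ofReal (k * s⁻¹)
          = ENNReal.ofReal ((s ^ (n + 2))⁻¹ * ((s - s / c₀) * (a * (c * s / c₀) ^ n))) := by
            congr 1
            rw [hk, mul_comm c, mul_div_assoc, mul_pow]
            field_simp
            ring
        _ ≤ (ENNReal.ofReal s ^ (n + 2))⁻¹ *
              stripMeasure n (Set.Ioo (s / c₀) s ×ˢ ball y (c * s / c₀)) := by
            have h1 : 0 ≤ s - s / c₀ := sub_nonneg.2 (div_le_self hs0.le hc₀.le)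
            rw [stripMeasure, Measure.prod_prod, Real.volume_Ioo,
              ENNReal.ofReal_mul (by positivity), ENNReal.ofReal_mul h1,
              ENNReal.ofReal_inv_of_pos (by positivity), ENNReal.ofReal_pow hs0.le]
            gcongr
            refine (hab y _ (by positivity)).1 ?_
            rw [div_le_iff₀ hc₀']
            nlinarith
        _ = ∫⁻ p in Set.Ioo (s / c₀) s ×ˢ ball y (c * s / c₀),
              (ENNReal.ofReal s ^ (n + 2))⁻¹ ∂stripMeasure n := by rw [setLIntegral_const]
        _ ≤ ∫⁻ p in Set.Ioo (s / c₀) s ×ˢ ball y (c * s / c₀),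
              T.indicator (fun q => D q.1) (p, (s, y)) ∂stripMeasure n := by
            refine setLIntegral_mono' hbox ?_
            rintro ⟨t, x⟩ ⟨⟨ht1, ht2⟩, hx⟩
            simp only at ht1 ht2 hx
            have ht0 : 0 < t := lt_trans (by positivity) ht1
            rw [div_lt_iff₀ hc₀'] at ht1
            have hmem : ((t, x), (s, y)) ∈ T := by
              refine ⟨⟨?_, ?_, ?_⟩, hs1⟩
              · rw [mem_ball, dist_comm, Subtype.dist_eq] at hx
                refine hx.trans_le ?_
                rw [div_le_iff₀ hc₀']
                nlinarith
              · simp only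
                exact (inv_lt_one_of_one_lt₀ hc₀).trans ((one_lt_div ht0).2 ht2)
              · simp only
                rw [div_lt_iff₀ ht0]
                linarith
            rw [Set.indicator_of_mem hmem]
            simp only [hD]
            gcongr
        _ ≤ _ := by
            refine lintegral_mono_set ?_
            rintro ⟨t, x⟩ ⟨⟨ht1, ht2⟩, -⟩
            simp only at ht1 ht2
            exact ⟨⟨lt_trans (by positivity) ht1, by simp only; linarith⟩, trivial⟩
    refine le_trans (le_of_eq ?_) (mul_le_mul_right hlow _)
    rw [← ENNReal.ofReal_mul (by positivity), ← ENNReal.ofReal_inv_of_pos hs0]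
    congr 1
    field_simp
  refine ⟨ENNReal.ofReal k⁻¹, ENNReal.ofReal_lt_top, fun H hH => ?_⟩
  have hmeas : Measurable fun q : (ℝ × UnitSphere n) × (ℝ × UnitSphere n) =>
      H q.1 * T.indicator (fun q => D q.1) (q.2, q.1) :=
    (hH.comp measurable_fst).mul (((hDm.comp measurable_fst).indicator hTm).comp measurable_swap)
  have hmeas' : Measurable fun q : (ℝ × UnitSphere n) × (ℝ × UnitSphere n) =>
      T.indicator (fun q => D q.1) q := (hDm.comp measurable_fst).indicator hTm
  calc ∫⁻ z in Set.Ioo 0 1 ×ˢ Set.univ, H z * (ENNReal.ofReal z.1)⁻¹ ∂stripMeasure n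
      ≤ ∫⁻ z in Set.Ioo 0 1 ×ˢ Set.univ, ENNReal.ofReal k⁻¹ *
          ∫⁻ p in Set.Ioo 0 c₀ ×ˢ Set.univ, H z * T.indicator (fun q => D q.1) (p, z)
            ∂stripMeasure n ∂stripMeasure n := by
        refine setLIntegral_mono' (measurableSet_Ioo.prod .univ) fun z hz => ?_
        have hz' : Measurable fun p => T.indicator (fun q => D q.1) (p, z) :=
          hmeas'.comp measurable_prodMk_right
        rw [lintegral_const_mul _ hz', mul_left_comm]
        gcongr
        exact hpoint z hz
    _ ≤ ENNReal.ofReal k⁻¹ * ∫⁻ z, ∫⁻ p in Set.Ioo 0 c₀ ×ˢ Set.univ,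
          H z * T.indicator (fun q => D q.1) (p, z) ∂stripMeasure n ∂stripMeasure n := by
        rw [lintegral_const_mul _ hmeas.lintegral_prod_right']
        gcongr
        exact Measure.restrict_le_self
    _ = ENNReal.ofReal k⁻¹ * ∫⁻ p in Set.Ioo 0 c₀ ×ˢ Set.univ,
          ∫⁻ z, H z * T.indicator (fun q => D q.1) (p, z) ∂stripMeasure n ∂stripMeasure n := by
        rw [lintegral_lintegral_swap hmeas.aemeasurable]
    _ = _ := by
        congr 1
        refine lintegral_congr fun p => ?_
        have hsec : MeasurableSet (whitneyRegion n c₀ c p.1 p.2 ∩ {z | z.1 < 1}) :=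
          measurable_prodMk_left (x := p) hTm
        rw [← lintegral_const_mul _ hH, ← lintegral_indicator hsec]
        refine lintegral_congr fun z => ?_
        by_cases hz : z ∈ whitneyRegion n c₀ c p.1 p.2 ∩ {z | z.1 < 1}
        · rw [Set.indicator_of_mem hz, Set.indicator_of_mem (show (p, z) ∈ T from hz), mul_comm]
        · rw [Set.indicator_of_notMem hz, Set.indicator_of_notMem (show (p, z) ∉ T from hz),
            mul_zero]

theorem setLIntegral_carleson_le (n N : ℕ) (c₀ c₁ r₀ : ℝ)
    (ℰ : ℝ × UnitSphere n → (EuclideanSpace ℂ (Fin N) →L[ℂ] EuclideanSpace ℂ (Fin N)))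
    (x₀ : UnitSphere n) {r : ℝ} (hr : 0 < r) (hr₀ : r < r₀) :
    ∫⁻ z in Set.Ioo (0 : ℝ) r ×ˢ ball x₀ r,
        (essSup (fun w => (‖ℰ w‖₊ : ℝ≥0∞))
            ((stripMeasure n).restrict (whitneyRegion n c₀ c₁ z.1 z.2))) ^ 2 *
          (ENNReal.ofReal z.1)⁻¹ ∂stripMeasure n ≤
      carlesonNorm n N c₀ c₁ r₀ ℰ ^ 2 * sphereMeasure n (ball x₀ r) := by
  have hpos : sphereMeasure n (ball x₀ r) ≠ 0 :=
    ((isOpen_ball (x := x₀)).measure_pos (volume : Measure (EuclideanSpace ℝ (Fin (n + 1)))).toSphere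
      (nonempty_ball.2 hr)).ne'
  rw [← ENNReal.div_le_iff hpos (measure_ne_top _ _), ENNReal.div_eq_inv_mul, carlesonNorm,
    ← ENNReal.rpow_two, ← ENNReal.rpow_mul, one_div, inv_mul_cancel₀ two_ne_zero,
    ENNReal.rpow_one]
  exact le_iSup₂_of_le x₀ r (le_iSup_of_le ⟨hr, hr₀⟩ le_rfl)

theorem whitneyRegion_subset_of_dist_lt {n : ℕ} {c₀ c₁ t : ℝ} {x y : UnitSphere n}
    (h : dist y x < c₁ / 2 * t) :
    whitneyRegion n c₀ (c₁ / 2) t x ⊆ whitneyRegion n c₀ c₁ t y := by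
  intro z hz
  refine ⟨?_, hz.2⟩
  have h1 := hz.1
  rw [← Subtype.dist_eq] at h1 ⊢
  have := dist_triangle_right z.2 y x
  linarith

/-- The part of the `𝒴*`-norm near the boundary is controlled by Carleson's embedding. -/
theorem exists_boundary_estimate (n N : ℕ) (c₀ c₁ r₀ : ℝ)
    (hc₀ : 1 < c₀) (hc₁ : 0 < c₁) (hr₀ : 0 < r₀) (hr₀' : r₀ < 1) :
    ∃ B : ℝ≥0∞, B < ⊤ ∧
      ∀ ℰ : ℝ × UnitSphere n → (EuclideanSpace ℂ (Fin N) →L[ℂ] EuclideanSpace ℂ (Fin N)),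
      (∀ v, Measurable (fun z => ℰ z v)) →
      ∀ f : ℝ × UnitSphere n → EuclideanSpace ℂ (Fin N), Measurable f →
      ∫⁻ z in Set.Ioo 0 1 ×ˢ Set.univ,
          ((‖ℰ z‖₊ : ℝ≥0∞) ^ 2 * (‖f z‖₊ : ℝ≥0∞) ^ 2) * (ENNReal.ofReal z.1)⁻¹ ∂stripMeasure n ≤
        B * (carlesonNorm n N c₀ c₁ r₀ ℰ ^ 2 +
          essSup (fun z => (‖ℰ z‖₊ : ℝ≥0∞))
            ((stripMeasure n).restrict (Set.Ioi (0 : ℝ) ×ˢ Set.univ)) ^ 2) *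
        ∫⁻ x, ntMaximal n N c₀ c₁ f x ^ 2 ∂sphereMeasure n := by
  obtain ⟨K, hK, havg⟩ := exists_whitney_averaging n c₀ (c₁ / 2) hc₀ (by positivity)
  obtain ⟨a, b, ha, hb, hab⟩ := sphereMeasure_ahlforsRegular n c₁
  set d := c₁ / 4 with hd
  have hd0 : 0 < d := by positivity
  set Q := 3 * d + 3 with hQ
  have hQ3 : 3 < Q := by linarith
  have hQ0 : 0 < Q := by linarith
  set δ := r₀ / Q with hδ
  have hδ0 : 0 < δ := by positivity
  have hδ1 : δ < 1 := (div_lt_one hQ0).2 (by linarith)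
  have hdoubling : ∀ (x : UnitSphere n) (t : ℝ), 0 < t → t < δ →
      sphereMeasure n (ball x (Q * t)) ≤
        ENNReal.ofReal (b * Q ^ n / (a * d ^ n)) * sphereMeasure n (closedBall x (d * t)) := by
    intro x t ht htδ
    have hle : d * t ≤ c₁ := by nlinarith
    calc sphereMeasure n (ball x (Q * t)) ≤ ENNReal.ofReal (b * (Q * t) ^ n) :=
          (hab x _ (by positivity)).2
      _ = ENNReal.ofReal (b * Q ^ n / (a * d ^ n)) * ENNReal.ofReal (a * (d * t) ^ n) := by
          rw [← ENNReal.ofReal_mul (by positivity)]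
          congr 1
          rw [mul_pow, mul_pow]
          field_simp
      _ ≤ _ := by
          gcongr
          exact ((hab x _ (by positivity)).1 hle).trans (measure_mono ball_subset_closedBall)
  set D := ENNReal.ofReal (b * Q ^ n / (a * d ^ n)) with hD
  set M := (ENNReal.ofReal δ)⁻¹ * ENNReal.ofReal (c₀ - δ) with hM
  have hMtop : M ≠ ⊤ := ENNReal.mul_ne_top
    (ENNReal.inv_ne_top.2 (by simpa using hδ0)) ENNReal.ofReal_ne_top
  refine ⟨K * (D + M), ENNReal.mul_lt_top hK
    (ENNReal.add_lt_top.2 ⟨ENNReal.ofReal_lt_top, hMtop.lt_top⟩), fun ℰ hℰ f hf => ?_⟩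
  set e : ℝ × UnitSphere n → ℝ≥0∞ := fun z => (‖ℰ z‖₊ : ℝ≥0∞) with he
  have hem : Measurable e := measurable_enorm_of_forall_apply hℰ
  set F : ℝ × UnitSphere n → ℝ≥0∞ := fun z => (‖f z‖₊ : ℝ≥0∞) ^ 2 with hF
  have hFm : Measurable F := hf.nnnorm.coe_nnreal_ennreal.pow_const 2
  set L := essSup e ((stripMeasure n).restrict (Set.Ioi (0 : ℝ) ×ˢ Set.univ)) with hL
  set κ := carlesonNorm n N c₀ c₁ r₀ ℰ with hκ
  set A : ℝ × UnitSphere n → ℝ≥0∞ := fun p =>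
    essSup e ((stripMeasure n).restrict (whitneyRegion n c₀ c₁ p.1 p.2)) with hA
  have hAm : Measurable A :=
    measurable_essSup_restrict_section _ (measurableSet_whitneyRegion n c₀ c₁) hem
  set P : ℝ × UnitSphere n → ℝ≥0∞ := fun p => A p ^ 2 * (ENNReal.ofReal p.1)⁻¹ with hP
  have hPm : Measurable P := by fun_prop
  set G : ℝ × UnitSphere n → ℝ≥0∞ := fun p => (ENNReal.ofReal p.1 ^ (n + 1))⁻¹ *
    ∫⁻ z in whitneyRegion n c₀ (c₁ / 2) p.1 p.2 ∩ {z | z.1 < 1}, F z ∂stripMeasure n with hG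
  have hGm : Measurable G := by
    refine Measurable.mul (by fun_prop) ?_
    exact measurable_setLIntegral_section _
      (measurableSet_whitneyRegion_lt_one n c₀ (c₁ / 2)) hFm
  have hGle : ∀ t x y, 0 < t → t < c₀ → dist y x < c₁ / 2 * t →
      G (t, x) ≤ ntMaximal n N c₀ c₁ f y ^ 2 := by
    intro t x y ht htc hdist
    refine le_trans ?_ (le_ntMaximal_sq n N c₀ c₁ f y ⟨ht, htc⟩)
    simp only [hG]
    gcongr
    exact whitneyRegion_subset_of_dist_lt hdist
  have hPG : ∀ p ∈ Set.Ioo 0 c₀ ×ˢ (Set.univ : Set (UnitSphere n)),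
      (ENNReal.ofReal p.1 ^ (n + 2))⁻¹ *
        ∫⁻ z in whitneyRegion n c₀ (c₁ / 2) p.1 p.2 ∩ {z | z.1 < 1}, e z ^ 2 * F z
          ∂stripMeasure n ≤ P p * G p := by
    rintro ⟨t, x⟩ ⟨⟨ht0, -⟩, -⟩
    simp only at ht0
    have hsub : whitneyRegion n c₀ (c₁ / 2) t x ∩ {z | z.1 < 1} ⊆ whitneyRegion n c₀ c₁ t x :=
      Set.inter_subset_left.trans (whitneyRegion_subset_of_dist_lt (by
        rw [dist_self]
        positivity))
    have hbound : ∫⁻ z in whitneyRegion n c₀ (c₁ / 2) t x ∩ {z | z.1 < 1}, e z ^ 2 * F z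
          ∂stripMeasure n ≤ A (t, x) ^ 2 *
        ∫⁻ z in whitneyRegion n c₀ (c₁ / 2) t x ∩ {z | z.1 < 1}, F z ∂stripMeasure n := by
      rw [← lintegral_const_mul _ hFm]
      refine lintegral_mono_ae ?_
      filter_upwards [ae_restrict_of_ae_restrict_of_subset hsub
        (ENNReal.ae_le_essSup (μ := (stripMeasure n).restrict (whitneyRegion n c₀ c₁ t x)) e)]
        with z hz
      gcongr
    have hpow : (ENNReal.ofReal t ^ (n + 2))⁻¹ =
        (ENNReal.ofReal t)⁻¹ * (ENNReal.ofReal t ^ (n + 1))⁻¹ := by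
      rw [pow_succ' _ (n + 1), ENNReal.mul_inv (.inr (by simp)) (.inl (by simp))]
    refine (mul_le_mul_right hbound _).trans (le_of_eq ?_)
    simp only [hP, hG]
    rw [hpow]
    ring
  have hnear : ∫⁻ p in Set.Ioo 0 δ ×ˢ Set.univ, P p * G p ∂stripMeasure n ≤
      κ ^ 2 * D * ∫⁻ x, ntMaximal n N c₀ c₁ f x ^ 2 ∂sphereMeasure n := by
    have hemb := carleson_embedding (sphereMeasure n) ((stripMeasure n).withDensity P)
      (a := d) (δ := δ) hd0 (κ := κ ^ 2 * D) (fun x t ht htδ => by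
        rw [withDensity_apply _ (measurableSet_Ioo.prod measurableSet_ball), mul_assoc]
        refine (setLIntegral_carleson_le n N c₀ c₁ r₀ ℰ x (by positivity) ?_).trans
          (mul_le_mul_right (hdoubling x t ht htδ) _)
        rw [mul_comm]
        exact (lt_div_iff₀ hQ0).1 htδ) hGm
      (g := fun x => ntMaximal n N c₀ c₁ f x ^ 2)
      (fun t x y ht htδ hdist => hGle t x y ht (by linarith) (by rw [hd] at hdist; linarith))
    rwa [setLIntegral_withDensity_eq_setLIntegral_mul _ hPm hGm
      (measurableSet_Ioo.prod .univ)] at hemb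
  have hAL : ∀ t x, 0 < t → A (t, x) ≤ L := by
    intro t x ht
    refine essSup_mono_measure' (Measure.restrict_mono_set _ ?_)
    intro z hz
    have h0 : 0 < z.1 / t := lt_trans (inv_pos.2 (by linarith)) hz.2.1
    exact ⟨(div_pos_iff_of_pos_right ht).1 h0, trivial⟩
  have hfar : ∫⁻ p in Set.Ico δ c₀ ×ˢ Set.univ, P p * G p ∂stripMeasure n ≤
      L ^ 2 * M * ∫⁻ x, ntMaximal n N c₀ c₁ f x ^ 2 ∂sphereMeasure n := by
    rw [setLIntegral_stripMeasure n _ (φ := fun p => P p * G p) (hPm.mul hGm)]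
    calc _ ≤ ∫⁻ t in Set.Ico δ c₀, L ^ 2 * (ENNReal.ofReal δ)⁻¹ *
          ∫⁻ x, ntMaximal n N c₀ c₁ f x ^ 2 ∂sphereMeasure n := by
          refine setLIntegral_mono' measurableSet_Ico fun t ht => ?_
          have ht0 : 0 < t := hδ0.trans_le ht.1
          calc ∫⁻ x, P (t, x) * G (t, x) ∂sphereMeasure n
              ≤ ∫⁻ x, L ^ 2 * (ENNReal.ofReal δ)⁻¹ * G (t, x) ∂sphereMeasure n := by
                refine lintegral_mono fun x => ?_
                simp only [hP]
                gcongr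
                · exact hAL t x ht0
                · exact ht.1
            _ = L ^ 2 * (ENNReal.ofReal δ)⁻¹ * ∫⁻ x, G (t, x) ∂sphereMeasure n :=
                lintegral_const_mul _ (hGm.comp measurable_prodMk_left)
            _ ≤ _ := by
                gcongr with x
                exact hGle t x x ht0 ht.2 (by rw [dist_self]; positivity)
      _ = _ := by
          rw [setLIntegral_const, Real.volume_Ico, hM]
          ring
  calc _ ≤ K * ∫⁻ p in Set.Ioo 0 c₀ ×ˢ Set.univ, P p * G p ∂stripMeasure n := by
        refine (havg _ ((hem.pow_const 2).mul hFm)).trans ?_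
        exact mul_le_mul_right (setLIntegral_mono' (measurableSet_Ioo.prod .univ) hPG) _
    _ ≤ K * (∫⁻ p in Set.Ioo 0 δ ×ˢ Set.univ, P p * G p ∂stripMeasure n +
          ∫⁻ p in Set.Ico δ c₀ ×ˢ Set.univ, P p * G p ∂stripMeasure n) := by
        gcongr
        refine (lintegral_mono_set ?_).trans (lintegral_union_le _ _ _)
        rintro ⟨t, x⟩ ⟨⟨ht0, htc⟩, -⟩
        rcases lt_or_ge t δ with h | h
        · exact .inl ⟨⟨ht0, h⟩, trivial⟩
        · exact .inr ⟨⟨h, htc⟩, trivial⟩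
    _ ≤ K * (κ ^ 2 * D * ∫⁻ x, ntMaximal n N c₀ c₁ f x ^ 2 ∂sphereMeasure n +
          L ^ 2 * M * ∫⁻ x, ntMaximal n N c₀ c₁ f x ^ 2 ∂sphereMeasure n) := by gcongr
    _ = K * (κ ^ 2 * D + L ^ 2 * M) * ∫⁻ x, ntMaximal n N c₀ c₁ f x ^ 2 ∂sphereMeasure n := by
        ring
    _ ≤ _ := by
        rw [mul_assoc K (D + M)]
        gcongr
        calc κ ^ 2 * D + L ^ 2 * M ≤ κ ^ 2 * (D + M) + L ^ 2 * (D + M) := by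
              gcongr
              · exact le_self_add
              · exact le_add_self
          _ = _ := by ring

/-- Upper bound for the multiplicator norm. -/
theorem exists_multiplicatorNorm_le (n N : ℕ) (c₀ c₁ r₀ : ℝ)
    (hc₀ : 1 < c₀) (hc₁ : 0 < c₁) (hr₀ : 0 < r₀) (hr₀' : r₀ < 1) :
    ∃ C : ℝ≥0∞, C < ⊤ ∧
      ∀ ℰ : ℝ × UnitSphere n → (EuclideanSpace ℂ (Fin N) →L[ℂ] EuclideanSpace ℂ (Fin N)),
      (∀ v, Measurable (fun z => ℰ z v)) →
      multiplicatorNorm n N c₀ c₁ ℰ ≤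
        C * (carlesonNorm n N c₀ c₁ r₀ ℰ +
          essSup (fun z => (‖ℰ z‖₊ : ℝ≥0∞))
            ((stripMeasure n).restrict (Set.Ioi (0 : ℝ) ×ˢ Set.univ))) := by
  obtain ⟨B, hB, hbdry⟩ := exists_boundary_estimate n N c₀ c₁ r₀ hc₀ hc₁ hr₀ hr₀'
  refine ⟨B + 1, ENNReal.add_lt_top.2 ⟨hB, ENNReal.one_lt_top⟩, fun ℰ hℰ => ?_⟩
  refine iSup₂_le fun f ⟨hf, hX⟩ => ?_
  set κ := carlesonNorm n N c₀ c₁ r₀ ℰ with hκ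
  set e : ℝ × UnitSphere n → ℝ≥0∞ := fun z => (‖ℰ z‖₊ : ℝ≥0∞) with he
  set L := essSup e ((stripMeasure n).restrict (Set.Ioi (0 : ℝ) ×ˢ Set.univ)) with hL
  have hem : Measurable e := measurable_enorm_of_forall_apply hℰ
  set F : ℝ × UnitSphere n → ℝ≥0∞ := fun z => (‖f z‖₊ : ℝ≥0∞) ^ 2 with hF
  have hFm : Measurable F := hf.nnnorm.coe_nnreal_ennreal.pow_const 2
  have heF : Measurable fun z => e z ^ 2 * F z := (hem.pow_const 2).mul hFm
  have hslice (s : ℝ) : sliceNormSq n N (fun z => ℰ z (f z)) s ≤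
      ∫⁻ x, e (s, x) ^ 2 * F (s, x) ∂sphereMeasure n := by
    refine lintegral_mono fun x => ?_
    simp only [he, hF]
    rw [← mul_pow]
    gcongr
    exact_mod_cast (ℰ (s, x)).le_opNNNorm _
  have hsmall : ∫⁻ s in Set.Ioo (0 : ℝ) 1,
      sliceNormSq n N (fun z => ℰ z (f z)) s * max (ENNReal.ofReal s)⁻¹ 1 ≤
        B * (κ ^ 2 + L ^ 2) := by
    calc _ ≤ ∫⁻ s in Set.Ioo (0 : ℝ) 1, ∫⁻ x, (e (s, x) ^ 2 * F (s, x)) * (ENNReal.ofReal s)⁻¹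
          ∂sphereMeasure n := by
          refine setLIntegral_mono' measurableSet_Ioo fun s hs => ?_
          have hs' : Measurable fun x => e (s, x) ^ 2 * F (s, x) :=
            heF.comp measurable_prodMk_left
          rw [lintegral_mul_const _ hs', max_eq_left]
          · gcongr
            exact hslice s
          · rw [ENNReal.one_le_inv]
            exact ENNReal.ofReal_le_one.2 hs.2.le
      _ = ∫⁻ z in Set.Ioo 0 1 ×ˢ Set.univ, (e z ^ 2 * F z) * (ENNReal.ofReal z.1)⁻¹
            ∂stripMeasure n := by
          rw [setLIntegral_stripMeasure n _ (by fun_prop)]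
      _ ≤ _ := hbdry ℰ hℰ f hf
      _ ≤ B * (κ ^ 2 + L ^ 2) * 1 := by
          gcongr
          exact le_self_add.trans hX
      _ = _ := mul_one _
  have hlarge : ∫⁻ s in Set.Ici (1 : ℝ),
      sliceNormSq n N (fun z => ℰ z (f z)) s * max (ENNReal.ofReal s)⁻¹ 1 ≤ L ^ 2 := by
    rw [← restrict_Ioi_eq_restrict_Ici]
    calc _ ≤ ∫⁻ s in Set.Ioi (1 : ℝ), ∫⁻ x, e (s, x) ^ 2 * F (s, x) ∂sphereMeasure n := by
          refine setLIntegral_mono' measurableSet_Ioi fun s hs => ?_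
          rw [max_eq_right, mul_one]
          · exact hslice s
          · rw [ENNReal.inv_le_one]
            exact ENNReal.one_le_ofReal.2 (le_of_lt hs)
      _ = ∫⁻ z in Set.Ioi 1 ×ˢ Set.univ, e z ^ 2 * F z ∂stripMeasure n := by
          rw [setLIntegral_stripMeasure n _ heF]
      _ ≤ ∫⁻ z in Set.Ioi 1 ×ˢ Set.univ, L ^ 2 * F z ∂stripMeasure n := by
          refine lintegral_mono_ae ?_
          have hsub : Set.Ioi (1 : ℝ) ×ˢ (Set.univ : Set (UnitSphere n)) ⊆
              Set.Ioi 0 ×ˢ Set.univ :=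
            Set.prod_mono_left (Set.Ioi_subset_Ioi zero_le_one)
          filter_upwards [ae_restrict_of_ae_restrict_of_subset hsub (ENNReal.ae_le_essSup e)]
            with z hz
          gcongr
      _ = L ^ 2 * ∫⁻ s in Set.Ioi 1, sliceNormSq n N f s := by
          rw [lintegral_const_mul _ hFm, setLIntegral_stripMeasure n _ hFm]
          rfl
      _ ≤ L ^ 2 * 1 := by
          gcongr
          exact le_add_self.trans hX
      _ = _ := mul_one _
  have hY : YstarNormSq n N (fun z => ℰ z (f z)) ≤ ((B + 1) * (κ + L)) ^ 2 := by
    calc YstarNormSq n N (fun z => ℰ z (f z)) ≤ B * (κ ^ 2 + L ^ 2) + L ^ 2 := by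
          rw [YstarNormSq, ← Set.Ioo_union_Ici_eq_Ioi one_pos]
          exact (lintegral_union_le _ _ _).trans (add_le_add hsmall hlarge)
      _ ≤ B * (κ + L) ^ 2 + (κ + L) ^ 2 := by
          have h1 : κ ^ 2 + L ^ 2 ≤ (κ + L) ^ 2 := by
            calc κ ^ 2 + L ^ 2 ≤ κ ^ 2 + L ^ 2 + 2 * κ * L := le_self_add
              _ = _ := by ring
          gcongr
          exact le_add_self
      _ = (B + 1) * (κ + L) ^ 2 := by ring
      _ ≤ (B + 1) ^ 2 * (κ + L) ^ 2 := by
          gcongr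
          exact le_self_pow₀ le_add_self two_ne_zero
      _ = _ := by ring
  rw [one_div, ENNReal.rpow_inv_le_iff two_pos, ENNReal.rpow_two]
  exact hY

theorem nnnorm_indicator_const_sq {α E : Type*} [SeminormedAddCommGroup E] (T : Set α) (v : E)
    (z : α) : (‖T.indicator (fun _ => v) z‖₊ : ℝ≥0∞) ^ 2 =
      T.indicator (fun _ => (‖v‖₊ : ℝ≥0∞) ^ 2) z := by
  by_cases hz : z ∈ T <;> simp [hz]

/-- A constant vector supported in a Whitney-type box not meeting `s = 1` has `𝒳`-norm
comparable to its weighted `L²`-norm. -/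
theorem exists_XnormSq_indicator_le (n N : ℕ) (c₀ c₁ : ℝ) (hc₀ : 1 < c₀) (hc₁ : 0 < c₁) :
    ∃ K : ℝ≥0∞, 1 ≤ K ∧ K < ⊤ ∧ ∀ (s₀ : ℝ) (y₀ : UnitSphere n) (T : Set (ℝ × UnitSphere n))
      (v : EuclideanSpace ℂ (Fin N)), 0 < s₀ → MeasurableSet T →
      T ⊆ Set.Ioo (s₀ / 2) (2 * s₀) ×ˢ ball y₀ s₀ →
      (T ⊆ {z | z.1 < 1} ∨ T ⊆ {z | 1 < z.1}) →
      XnormSq n N c₀ c₁ (T.indicator fun _ => v) ≤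
        K * ((‖v‖₊ : ℝ≥0∞) ^ 2 * ∫⁻ z in T, max (ENNReal.ofReal z.1)⁻¹ 1 ∂stripMeasure n) := by
  obtain ⟨_, b, _, hb, hab⟩ := sphereMeasure_ahlforsRegular n 1
  have hc₀' : 0 < c₀ := one_pos.trans hc₀
  set Λ := 2 * c₀ * c₁ + 1 with hΛ
  have hΛ0 : 0 < Λ := by positivity
  set k := 2 * ((2 * c₀) ^ (n + 1) * (b * Λ ^ n)) with hk
  refine ⟨ENNReal.ofReal k + 1, le_add_self,
    ENNReal.add_lt_top.2 ⟨ENNReal.ofReal_lt_top, ENNReal.one_lt_top⟩,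
    fun s₀ y₀ T v hs₀ hT hbox hside => ?_⟩
  set V := (‖v‖₊ : ℝ≥0∞) ^ 2 with hV
  have hind (S : Set (ℝ × UnitSphere n)) (hS : MeasurableSet S) :
      ∫⁻ z in S, T.indicator (fun _ => V) z ∂stripMeasure n = V * stripMeasure n (T ∩ S) := by
    rw [lintegral_indicator_const hT, Measure.restrict_apply hT]
  have hnt (x : UnitSphere n) (B : ℝ≥0∞)
      (h : ∀ t ∈ Set.Ioo 0 c₀, (ENNReal.ofReal t ^ (n + 1))⁻¹ * (V * stripMeasure n
        (T ∩ (whitneyRegion n c₀ c₁ t x ∩ {z | z.1 < 1}))) ≤ B) :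
      ntMaximal n N c₀ c₁ (T.indicator fun _ => v) x ^ 2 ≤ B := by
    refine ntMaximal_sq_le n N c₀ c₁ _ x fun t ht => ?_
    have hsec : MeasurableSet (whitneyRegion n c₀ c₁ t x ∩ {z | z.1 < 1}) :=
      measurable_prodMk_left (x := (t, x)) (measurableSet_whitneyRegion_lt_one n c₀ c₁)
    simp_rw [nnnorm_indicator_const_sq]
    exact (mul_le_mul_right (hind _ hsec).le _).trans (h t ht)
  have htail : ∫⁻ s in Set.Ioi (1 : ℝ), sliceNormSq n N (T.indicator fun _ => v) s =
      V * stripMeasure n (T ∩ Set.Ioi 1 ×ˢ Set.univ) := by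
    rw [← hind _ (measurableSet_Ioi.prod .univ),
      setLIntegral_stripMeasure n _ (measurable_const.indicator hT)]
    refine lintegral_congr fun s => lintegral_congr fun x => ?_
    rw [nnnorm_indicator_const_sq]
  rw [XnormSq, htail, add_mul, one_mul]
  rcases hside with hside | hside
  · have htail0 : T ∩ Set.Ioi 1 ×ˢ Set.univ = ∅ := by
      refine Set.eq_empty_of_forall_notMem fun z hz => ?_
      exact lt_asymm (show z.1 < 1 from hside hz.1) hz.2.1
    rw [htail0, measure_empty, mul_zero, add_zero]
    refine le_add_right ?_
    set c := ENNReal.ofReal ((2 * c₀ / s₀) ^ (n + 1)) * (V * stripMeasure n T) with hc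
    have hpt (x : UnitSphere n) : ntMaximal n N c₀ c₁ (T.indicator fun _ => v) x ^ 2 ≤
        (ball y₀ (Λ * s₀)).indicator (fun _ => c) x := by
      refine hnt x _ fun t ht => ?_
      rcases Set.eq_empty_or_nonempty
        (T ∩ (whitneyRegion n c₀ c₁ t x ∩ {z | z.1 < 1})) with hempty | ⟨z, hzT, hzW, -⟩
      · rw [hempty, measure_empty, mul_zero, mul_zero]
        exact zero_le
      · obtain ⟨⟨hz1, hz2⟩, hz3⟩ := hbox hzT
        obtain ⟨hw1, hw2, hw3⟩ := hzW
        have ht0 : 0 < t := ht.1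
        rw [lt_div_iff₀ ht0, inv_mul_lt_iff₀ hc₀'] at hw2
        rw [div_lt_iff₀ ht0] at hw3
        rw [← Subtype.dist_eq] at hw1
        have hxball : x ∈ ball y₀ (Λ * s₀) := by
          rw [mem_ball] at hz3 ⊢
          have htri := dist_triangle_left x y₀ z.2
          have h4 : t < 2 * c₀ * s₀ := by nlinarith
          have h5 : c₁ * t ≤ c₁ * (2 * c₀ * s₀) := by gcongr
          rw [hΛ]
          linarith
        rw [Set.indicator_of_mem hxball, hc]
        gcongr
        · rw [← ENNReal.ofReal_pow ht0.le, ← ENNReal.ofReal_inv_of_pos (by positivity), ← inv_pow]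
          refine ENNReal.ofReal_le_ofReal (pow_le_pow_left₀ (by positivity) ?_ _)
          rw [inv_le_comm₀ ht0 (by positivity), inv_div, div_le_iff₀ (by positivity)]
          linarith
        · exact Set.inter_subset_left
    have hweight : (ENNReal.ofReal s₀)⁻¹ * stripMeasure n T ≤
        2 * ∫⁻ z in T, max (ENNReal.ofReal z.1)⁻¹ 1 ∂stripMeasure n := by
      rw [← setLIntegral_const, ← lintegral_const_mul _ (by fun_prop)]
      refine setLIntegral_mono' hT fun z hz => ?_
      obtain ⟨⟨hz1, hz2⟩, -⟩ := hbox hz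
      have hz0 : 0 < z.1 := lt_trans (by positivity) hz1
      refine le_trans ?_ (mul_le_mul_right (le_max_left _ _) 2)
      have htwo : 2 * ENNReal.ofReal z.1⁻¹ = ENNReal.ofReal (2 * z.1⁻¹) := by
        rw [ENNReal.ofReal_mul zero_le_two, ENNReal.ofReal_ofNat]
      rw [← ENNReal.ofReal_inv_of_pos hs₀, ← ENNReal.ofReal_inv_of_pos hz0, htwo]
      refine ENNReal.ofReal_le_ofReal ?_
      rw [← div_eq_mul_inv, le_div_iff₀ hz0, inv_mul_le_iff₀ hs₀]
      linarith
    calc ∫⁻ x, ntMaximal n N c₀ c₁ (T.indicator fun _ => v) x ^ 2 ∂sphereMeasure n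
        ≤ c * sphereMeasure n (ball y₀ (Λ * s₀)) := by
          rw [← lintegral_indicator_const measurableSet_ball]
          exact lintegral_mono hpt
      _ ≤ c * ENNReal.ofReal (b * (Λ * s₀) ^ n) := by
          gcongr
          exact (hab y₀ _ (by positivity)).2
      _ = ENNReal.ofReal ((2 * c₀) ^ (n + 1) * (b * Λ ^ n)) *
            (V * ((ENNReal.ofReal s₀)⁻¹ * stripMeasure n T)) := by
          have h : (2 * c₀ / s₀) ^ (n + 1) * (b * (Λ * s₀) ^ n) =
              (2 * c₀) ^ (n + 1) * (b * Λ ^ n) * s₀⁻¹ := by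
            rw [div_pow, mul_pow Λ]
            field_simp
            ring
          rw [hc, mul_right_comm, ← ENNReal.ofReal_mul (by positivity), h,
            ENNReal.ofReal_mul (by positivity), ENNReal.ofReal_inv_of_pos hs₀]
          ring
      _ ≤ ENNReal.ofReal ((2 * c₀) ^ (n + 1) * (b * Λ ^ n)) *
            (V * (2 * ∫⁻ z in T, max (ENNReal.ofReal z.1)⁻¹ 1 ∂stripMeasure n)) := by gcongr
      _ = _ := by
          rw [hk, ENNReal.ofReal_mul zero_le_two, ENNReal.ofReal_ofNat]
          ring
  · have hzero (x : UnitSphere n) : ntMaximal n N c₀ c₁ (T.indicator fun _ => v) x ^ 2 ≤ 0 := by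
      refine hnt x _ fun t _ => ?_
      have hempty : T ∩ (whitneyRegion n c₀ c₁ t x ∩ {z | z.1 < 1}) = ∅ := by
        refine Set.eq_empty_of_forall_notMem fun z hz => ?_
        exact lt_asymm (show 1 < z.1 from hside hz.1) hz.2.2
      rw [hempty, measure_empty, mul_zero, mul_zero]
    have hmax0 : ∫⁻ x, ntMaximal n N c₀ c₁ (T.indicator fun _ => v) x ^ 2 ∂sphereMeasure n ≤ 0 :=
      (lintegral_mono hzero).trans_eq lintegral_zero
    rw [nonpos_iff_eq_zero.1 hmax0, zero_add]
    refine le_add_left ?_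
    gcongr
    calc stripMeasure n (T ∩ Set.Ioi 1 ×ˢ Set.univ) ≤ stripMeasure n T :=
          measure_mono Set.inter_subset_left
      _ = ∫⁻ _ in T, 1 ∂stripMeasure n := (setLIntegral_one _).symm
      _ ≤ _ := lintegral_mono fun z => le_max_right _ _

theorem nnnorm_le_sum_nnnorm_basis {N : ℕ}
    (A : EuclideanSpace ℂ (Fin N) →L[ℂ] EuclideanSpace ℂ (Fin N)) :
    ‖A‖₊ ≤ ∑ i, ‖A (EuclideanSpace.basisFun (Fin N) ℂ i)‖₊ := by
  refine A.opNNNorm_le_bound _ fun v => ?_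
  set b := EuclideanSpace.basisFun (Fin N) ℂ
  conv_lhs => rw [← b.sum_repr' v]
  rw [map_sum, Finset.sum_mul]
  refine (nnnorm_sum_le _ _).trans (Finset.sum_le_sum fun i _ => ?_)
  rw [map_smul, nnnorm_smul, mul_comm]
  gcongr
  have h := nnnorm_inner_le_nnnorm (𝕜 := ℂ) (b i) v
  rwa [b.nnnorm_eq_one, one_mul] at h

/-- Lower bound for the multiplicator norm. -/
theorem exists_essSup_le_multiplicatorNorm (n N : ℕ) (c₀ c₁ : ℝ) (hN : 1 ≤ N)
    (hc₀ : 1 < c₀) (hc₁ : 0 < c₁) :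
    ∃ C : ℝ≥0∞, C < ⊤ ∧
      ∀ ℰ : ℝ × UnitSphere n → (EuclideanSpace ℂ (Fin N) →L[ℂ] EuclideanSpace ℂ (Fin N)),
      (∀ v, Measurable (fun z => ℰ z v)) →
      essSup (fun z => (‖ℰ z‖₊ : ℝ≥0∞))
          ((stripMeasure n).restrict (Set.Ioi (0 : ℝ) ×ˢ Set.univ)) ≤
        C * multiplicatorNorm n N c₀ c₁ ℰ := by
  obtain ⟨K, hK1, hKtop, hX⟩ := exists_XnormSq_indicator_le n N c₀ c₁ hc₀ hc₁
  have hK0 : K ≠ 0 := (one_pos.trans_le hK1).ne'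
  have hN0 : (N : ℝ≥0∞) ≠ 0 := by
    exact_mod_cast (Nat.pos_of_ne_zero (by omega)).ne'
  refine ⟨N * K, ENNReal.mul_lt_top (ENNReal.natCast_lt_top N) hKtop, fun ℰ hℰ => ?_⟩
  set M := multiplicatorNorm n N c₀ c₁ ℰ with hM
  set b := EuclideanSpace.basisFun (Fin N) ℂ with hb
  refine le_of_forall_gt_imp_ge_of_dense fun l hl => essSup_le_of_ae_le l ?_
  by_contra hnot
  set w : ℝ × UnitSphere n → ℝ≥0∞ := fun z => max (ENNReal.ofReal z.1)⁻¹ 1 with hw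
  have hwm : Measurable w := by fun_prop
  set S : Fin N → Set (ℝ × UnitSphere n) := fun i =>
    {z | l / N ≤ (‖ℰ z (b i)‖₊ : ℝ≥0∞)} ∩ ((Set.Ioi 0 ×ˢ Set.univ) ∩ {z | z.1 ≠ 1}) with hS
  have hSm (i : Fin N) : MeasurableSet (S i) :=
    (measurableSet_le measurable_const (hℰ _).nnnorm.coe_nnreal_ennreal).inter
      ((measurableSet_Ioi.prod .univ).inter
        (measurable_fst (measurableSet_singleton (1 : ℝ)).compl))
  have hne_one : stripMeasure n {z | ¬ z.1 ≠ 1} = 0 := by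
    have : {z : ℝ × UnitSphere n | ¬ z.1 ≠ 1} = {1} ×ˢ Set.univ := by
      ext z
      simp
    rw [this, stripMeasure, Measure.prod_prod]
    simp
  have hSpos : ∃ i, stripMeasure n (S i) ≠ 0 := by
    by_contra! hzero
    refine hnot ?_
    have hall : ∀ᵐ z ∂stripMeasure n, ∀ i, z ∉ S i :=
      ae_all_iff.2 fun i => measure_eq_zero_iff_ae_notMem.1 (hzero i)
    have hae1 : ∀ᵐ z ∂stripMeasure n, z.1 ≠ 1 := hne_one
    filter_upwards [ae_restrict_of_ae hall, ae_restrict_of_ae hae1,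
      ae_restrict_mem (measurableSet_Ioi.prod .univ)] with z hz hz1 hz0
    have hlt (i : Fin N) : (‖ℰ z (b i)‖₊ : ℝ≥0∞) ≤ l / N := by
      by_contra! hgt
      exact hz i ⟨hgt.le, hz0, hz1⟩
    calc (‖ℰ z‖₊ : ℝ≥0∞) ≤ ∑ i, (‖ℰ z (b i)‖₊ : ℝ≥0∞) := by
          exact_mod_cast nnnorm_le_sum_nnnorm_basis (ℰ z)
      _ ≤ ∑ _i : Fin N, l / N := Finset.sum_le_sum fun i _ => hlt i
      _ = l := by
          rw [Finset.sum_const, Finset.card_univ, Fintype.card_fin, nsmul_eq_mul]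
          exact ENNReal.mul_div_cancel hN0 (ENNReal.natCast_ne_top N)
  obtain ⟨i, hi⟩ := hSpos
  obtain ⟨⟨s₀, y₀⟩, ⟨-, ⟨hs₀, -⟩, hs₁⟩, hnhds⟩ := exists_mem_forall_mem_nhdsWithin_pos_measure hi
  replace hs₀ : 0 < s₀ := hs₀
  replace hs₁ : s₀ ≠ 1 := hs₁
  obtain ⟨J, hJopen, hsJ, hJ⟩ : ∃ J : Set ℝ, IsOpen J ∧ s₀ ∈ J ∧
      (J ⊆ Set.Iio 1 ∨ J ⊆ Set.Ioi 1) := by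
    rcases lt_or_gt_of_ne hs₁ with h | h
    · exact ⟨Set.Iio 1, isOpen_Iio, h, .inl subset_rfl⟩
    · exact ⟨Set.Ioi 1, isOpen_Ioi, h, .inr subset_rfl⟩
  set U : Set (ℝ × UnitSphere n) := (Set.Ioo (s₀ / 2) (2 * s₀) ∩ J) ×ˢ ball y₀ s₀ with hU
  have hUopen : IsOpen U := (isOpen_Ioo.inter hJopen).prod isOpen_ball
  have hUmem : (s₀, y₀) ∈ U :=
    ⟨⟨⟨by simp only; linarith, by simp only; linarith⟩, hsJ⟩, mem_ball_self hs₀⟩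
  set T := S i ∩ U with hT
  have hTm : MeasurableSet T := (hSm i).inter hUopen.measurableSet
  have hTpos : 0 < stripMeasure n T :=
    hnhds _ (Filter.inter_mem self_mem_nhdsWithin
      (mem_nhdsWithin_of_mem_nhds (hUopen.mem_nhds hUmem)))
  have hTbox : T ⊆ Set.Ioo (s₀ / 2) (2 * s₀) ×ˢ ball y₀ s₀ :=
    Set.inter_subset_right.trans (Set.prod_mono_left Set.inter_subset_left)
  have hTside : T ⊆ {z | z.1 < 1} ∨ T ⊆ {z | 1 < z.1} :=
    hJ.imp (fun h z hz => h hz.2.1.2) fun h z hz => h hz.2.1.2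
  set m := ∫⁻ z in T, w z ∂stripMeasure n with hm
  have hm0 : m ≠ 0 := by
    refine (hTpos.trans_le ?_).ne'
    rw [← setLIntegral_one]
    exact lintegral_mono fun z => le_max_right _ _
  have hmtop : m ≠ ⊤ := by
    have hTfin : stripMeasure n T < ⊤ := by
      refine (measure_mono hTbox).trans_lt ?_
      rw [stripMeasure, Measure.prod_prod, Real.volume_Ioo]
      exact ENNReal.mul_lt_top ENNReal.ofReal_lt_top (measure_lt_top _ _)
    refine ne_top_of_le_ne_top
      (b := max (ENNReal.ofReal (s₀ / 2))⁻¹ 1 * stripMeasure n T) ?_ ?_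
    · refine ENNReal.mul_ne_top (max_lt ?_ ENNReal.one_lt_top).ne hTfin.ne
      rw [ENNReal.inv_lt_top]
      simpa using hs₀
    · rw [← setLIntegral_const]
      refine setLIntegral_mono' hTm fun z hz => ?_
      simp only [hw]
      gcongr
      exact (hTbox hz).1.1.le
  have hKm0 : K * m ≠ 0 := mul_ne_zero hK0 hm0
  have hKmtop : K * m ≠ ⊤ := ENNReal.mul_ne_top hKtop.ne hmtop
  set q : ℝ≥0 := NNReal.sqrt (K * m)⁻¹.toNNReal with hq
  set v : EuclideanSpace ℂ (Fin N) := ((q : ℝ) : ℂ) • b i with hv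
  have hqsq : (q : ℝ≥0∞) ^ 2 = (K * m)⁻¹ := by
    rw [← ENNReal.coe_pow, hq, NNReal.sq_sqrt, ENNReal.coe_toNNReal (ENNReal.inv_ne_top.2 hKm0)]
  have hnq : ‖((q : ℝ) : ℂ)‖₊ = q := by
    ext
    simp
  have hvn : ‖v‖₊ = q := by
    rw [hv, nnnorm_smul, hnq, b.nnnorm_eq_one, mul_one]
  have hXle : XnormSq n N c₀ c₁ (T.indicator fun _ => v) ≤ 1 := by
    refine (hX s₀ y₀ T v hs₀ hTm hTbox hTside).trans (le_of_eq ?_)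
    rw [hvn, hqsq, mul_left_comm]
    exact ENNReal.inv_mul_cancel hKm0 hKmtop
  have hYle : YstarNormSq n N (fun z => ℰ z (T.indicator (fun _ => v) z)) ≤ M ^ 2 := by
    have h : YstarNormSq n N (fun z => ℰ z (T.indicator (fun _ => v) z)) ^ ((1 : ℝ) / 2) ≤ M :=
      le_iSup₂_of_le (T.indicator fun _ => v) ⟨measurable_const.indicator hTm, hXle⟩ le_rfl
    rwa [one_div, ENNReal.rpow_inv_le_iff two_pos, ENNReal.rpow_two] at h
  have hYge : (l / N) ^ 2 * (K * m)⁻¹ * m ≤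
      YstarNormSq n N (fun z => ℰ z (T.indicator (fun _ => v) z)) := by
    have hTpos' : T ⊆ Set.Ioi 0 ×ˢ Set.univ := fun z hz => hz.1.2.1
    have hindm : Measurable (T.indicator fun _ => (l / N) ^ 2 * (K * m)⁻¹) :=
      measurable_const.indicator hTm
    calc (l / N) ^ 2 * (K * m)⁻¹ * m
        = ∫⁻ z in Set.Ioi 0 ×ˢ Set.univ,
            T.indicator (fun _ => (l / N) ^ 2 * (K * m)⁻¹) z * w z ∂stripMeasure n := by
          simp_rw [← Set.indicator_mul_left]
          rw [setLIntegral_indicator hTm, Set.inter_eq_left.2 hTpos', lintegral_const_mul _ hwm]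
      _ = ∫⁻ s in Set.Ioi 0, (∫⁻ x, T.indicator (fun _ => (l / N) ^ 2 * (K * m)⁻¹) (s, x)
            ∂sphereMeasure n) * max (ENNReal.ofReal s)⁻¹ 1 := by
          rw [setLIntegral_stripMeasure n _
            (φ := fun z => T.indicator (fun _ => (l / N) ^ 2 * (K * m)⁻¹) z * w z)
            (hindm.mul hwm)]
          refine lintegral_congr fun s => ?_
          exact lintegral_mul_const (max (ENNReal.ofReal s)⁻¹ 1)
            (hindm.comp (measurable_prodMk_left (x := s)))
      _ ≤ _ := by
          refine lintegral_mono fun s => mul_le_mul_left (lintegral_mono fun x => ?_) _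
          by_cases hz : (s, x) ∈ T
          · have hlow : l / N ≤ (‖ℰ (s, x) (b i)‖₊ : ℝ≥0∞) := hz.1.1
            simp only [Set.indicator_of_mem hz]
            rw [hv, map_smul, nnnorm_smul, hnq, ENNReal.coe_mul, mul_pow, hqsq, mul_comm]
            gcongr
          · rw [Set.indicator_of_notMem hz]
            exact zero_le
  have hfin : l ≤ N * K * M := by
    have h1 : (l / N) ^ 2 ≤ (K * M) ^ 2 := by
      calc (l / N) ^ 2 = K * ((l / N) ^ 2 * (K * m)⁻¹ * m) := by
            rw [show K * ((l / N) ^ 2 * (K * m)⁻¹ * m) = (l / N) ^ 2 * ((K * m)⁻¹ * (K * m)) by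
              ring, ENNReal.inv_mul_cancel hKm0 hKmtop, mul_one]
        _ ≤ K * M ^ 2 := by
            gcongr
            exact hYge.trans hYle
        _ ≤ K ^ 2 * M ^ 2 := by
            gcongr
            exact le_self_pow₀ hK1 two_ne_zero
        _ = _ := by ring
    have h2 : l / N ≤ K * M := (ENNReal.pow_le_pow_left_iff two_ne_zero).1 h1
    rw [ENNReal.div_le_iff hN0 (ENNReal.natCast_ne_top N)] at h2
    calc l ≤ K * M * N := h2
      _ = _ := by ring
  exact absurd hl (not_lt.2 hfin)

/-- **Comparison of the multiplicator norm with the Carleson and `L_∞` norms:**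
`‖ℰ‖_∞ ≲ ‖ℰ‖_*` and `‖ℰ‖_* ≲ ‖ℰ‖_C + ‖ℰ‖_∞`. -/
theorem multiplicatorNorm_comparison
    (n N : ℕ) (hn : 1 ≤ n) (hN : 1 ≤ N) (c₀ c₁ r₀ : ℝ)
    (hc₀ : 1 < c₀) (hc₁ : 0 < c₁) (hr₀ : 0 < r₀) (hr₀' : r₀ < 1) :
    ∃ C C' : ℝ≥0∞, C < ⊤ ∧ C' < ⊤ ∧
    ∀ ℰ : ℝ × sphere (0 : EuclideanSpace ℝ (Fin (n + 1))) 1 →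
        (EuclideanSpace ℂ (Fin N) →L[ℂ] EuclideanSpace ℂ (Fin N)),
      (∀ v, Measurable (fun z => ℰ z v)) →
      essSup (fun z => (‖ℰ z‖₊ : ℝ≥0∞))
          ((stripMeasure n).restrict (Set.Ioi (0 : ℝ) ×ˢ Set.univ)) ≤
        C * multiplicatorNorm n N c₀ c₁ ℰ ∧
      multiplicatorNorm n N c₀ c₁ ℰ ≤
        C' * (carlesonNorm n N c₀ c₁ r₀ ℰ +
          essSup (fun z => (‖ℰ z‖₊ : ℝ≥0∞))
            ((stripMeasure n).restrict (Set.Ioi (0 : ℝ) ×ˢ Set.univ))) := by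
  obtain ⟨C, hC, hlower⟩ := exists_essSup_le_multiplicatorNorm n N c₀ c₁ hN hc₀ hc₁
  obtain ⟨C', hC', hupper⟩ := exists_multiplicatorNorm_le n N c₀ c₁ r₀ hc₀ hc₁ hr₀ hr₀'
  exact ⟨C, C', hC, hC', fun ℰ hℰ => ⟨hlower ℰ hℰ, hupper ℰ hℰ⟩⟩
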